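/- arXiv:2205.05726 — 3 statements merged into one kernel-verified Lean document; each statement's English description precedes it below -/
import Mathlib

section
/- Let G = (V, E) be a finite simple undirected graph and let E' ⊆ E be a nonempty subset of its edges. Then |Aut(G)| · |AO_{G−E'}(E')| = |Aut(G − E')| · |AO_G(E')|; equivalently, |Aut(G)| / |AO_G(E')| = |Aut(G − E')| / |AO_{G−E'}(E')|. -/
/-- The set of automorphisms of a simple graph `G`: permutations `σ` of the
vertex set with `(a,b) ∈ E ↔ (σ a, σ b) ∈ E`. -/
def autSet {V : Type*} (G : SimpleGraph V) : Set (Equiv.Perm V) :=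
  {σ | ∀ a b : V, G.Adj a b ↔ G.Adj (σ a) (σ b)}

/-- The image of a set of unordered pairs under a permutation of the vertices. -/
def pairSetMap {V : Type*} (σ : Equiv.Perm V) (S : Set (Sym2 V)) : Set (Sym2 V) :=
  (Sym2.map σ) '' S

/-- The automorphism orbit of a set `S` of unordered vertex pairs in `G`:
`AO_G(S) = { σ(S) : σ ∈ Aut(G) }`. -/
def edgeSetOrbit {V : Type*} (G : SimpleGraph V) (S : Set (Sym2 V)) : Set (Set (Sym2 V)) :=
  {T | ∃ σ ∈ autSet G, pairSetMap σ S = T}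

/-- The automorphism orbit of a vertex `v` in `G`: `AO_G(v) = { σ v : σ ∈ Aut(G) }`. -/
def vertexOrbit {V : Type*} (G : SimpleGraph V) (v : V) : Set V :=
  {u | ∃ σ ∈ autSet G, σ v = u}

/-- `F` is an edge set on `V` forming a graph isomorphic to `G` (via a bijection of
the common vertex set carrying the edge set of `G` exactly onto `F`). -/
def isIsoEdgeSet {V : Type*} (G : SimpleGraph V) (F : Set (Sym2 V)) : Prop :=
  ∃ σ : Equiv.Perm V, pairSetMap σ G.edgeSet = F

/-- The action of the permutations of `V` on sets of unordered pairs by `pairSetMap`. -/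
abbrev pairSetMulAction (V : Type*) : MulAction (Equiv.Perm V) (Set (Sym2 V)) where
  smul := pairSetMap
  one_smul S := by
    change Sym2.map (id : V → V) '' S = S
    simp
  mul_smul σ τ S := by
    change Sym2.map (σ ∘ τ) '' S = Sym2.map σ '' (Sym2.map τ '' S)
    rw [Sym2.map_comp, Set.image_comp]

/-- Orbit-stabilizer, for the action of a subgroup and in terms of `Set.ncard`. -/
theorem Subgroup.ncard_eq_ncard_orbit_mul_ncard_stabilizer {P X : Type*} [Group P]
    [MulAction P X] (A : Subgroup P) (x : X) :
    (A : Set P).ncard =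
      {y | ∃ a ∈ (A : Set P), a • x = y}.ncard * {a | a ∈ A ∧ a • x = x}.ncard := by
  have horbit : {y | ∃ a ∈ (A : Set P), a • x = y} = MulAction.orbit A x := by
    ext y
    simp [MulAction.mem_orbit_iff, Subgroup.smul_def]
  have hstab : {a | a ∈ A ∧ a • x = x} =
      Subtype.val '' (MulAction.stabilizer A x : Set A) := by
    ext a
    simp [MulAction.mem_stabilizer_iff, Subgroup.smul_def, and_comm]
  rw [horbit, hstab, Set.ncard_image_of_injective _ Subtype.val_injective]
  have h := Nat.card_congr (MulAction.orbitProdStabilizerEquivGroup A x)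
  rw [Nat.card_prod] at h
  exact h.symm

/-- An automorphism of `G` is a permutation that maps its edge set onto itself. -/
theorem mem_autSet_iff_pairSetMap_edgeSet {V : Type*} (G : SimpleGraph V) (σ : Equiv.Perm V) :
    σ ∈ autSet G ↔ pairSetMap σ G.edgeSet = G.edgeSet := by
  have hinj : Function.Injective (Sym2.map σ) := Sym2.map.injective σ.injective
  constructor
  · intro h
    ext e
    induction e with | _ a b
    have hab : s(a, b) = Sym2.map σ s(σ.symm a, σ.symm b) := by simp
    rw [hab, pairSetMap, hinj.mem_set_image]
    simpa using h (σ.symm a) (σ.symm b)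
  · intro h a b
    rw [← SimpleGraph.mem_edgeSet, ← SimpleGraph.mem_edgeSet, ← Sym2.map_mk, ← hinj.mem_set_image]
    exact iff_of_eq (congrArg (_ ∈ ·) h)

/-- Orbit-stabilizer for the orbit of a set of unordered pairs under the automorphisms of `G`. -/
theorem ncard_autSet_eq_ncard_edgeSetOrbit_mul {V : Type*} (G : SimpleGraph V)
    (S : Set (Sym2 V)) :
    (autSet G).ncard =
      (edgeSetOrbit G S).ncard * {σ | σ ∈ autSet G ∧ pairSetMap σ S = S}.ncard := by
  let := pairSetMulAction V
  have haut : autSet G = (MulAction.stabilizer (Equiv.Perm V) G.edgeSet : Set _) :=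
    Set.ext (mem_autSet_iff_pairSetMap_edgeSet G)
  unfold edgeSetOrbit
  rw [haut]
  exact Subgroup.ncard_eq_ncard_orbit_mul_ncard_stabilizer _ S

/-- Among the permutations fixing `S ⊆ E`, the automorphisms of `G` and `G - S` are the same. -/
theorem mem_autSet_and_iff_deleteEdges {V : Type*} (G : SimpleGraph V) {S : Set (Sym2 V)}
    (hS : S ⊆ G.edgeSet) (σ : Equiv.Perm V) :
    σ ∈ autSet G ∧ pairSetMap σ S = S ↔
      σ ∈ autSet (G.deleteEdges S) ∧ pairSetMap σ S = S := by
  have hinj : Function.Injective (Sym2.map σ) := Sym2.map.injective σ.injective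
  refine and_congr_left fun hσ => ?_
  rw [mem_autSet_iff_pairSetMap_edgeSet, mem_autSet_iff_pairSetMap_edgeSet,
    SimpleGraph.edgeSet_deleteEdges]
  unfold pairSetMap at hσ ⊢
  rw [Set.image_sdiff hinj, hσ]
  refine ⟨fun h => by rw [h], fun h => ?_⟩
  have hS' : S ⊆ Sym2.map σ '' G.edgeSet := hσ.symm.subset.trans (Set.image_mono hS)
  rw [← Set.sdiff_union_of_subset hS', h, Set.sdiff_union_of_subset hS]

/-- For a finite simple undirected graph `G = (V, E)` and a nonempty
subset `E' ⊆ E` of its edges,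
`|Aut(G)| · |AO_{G−E'}(E')| = |Aut(G − E')| · |AO_G(E')|`. -/
theorem aut_mul_orbit_eq_of_deleteEdges {V : Type*} [Fintype V]
    (G : SimpleGraph V) (E' : Set (Sym2 V))
    (hsub : E' ⊆ G.edgeSet) (hne : E'.Nonempty) :
    (autSet G).ncard * (edgeSetOrbit (G.deleteEdges E') E').ncard =
      (autSet (G.deleteEdges E')).ncard * (edgeSetOrbit G E').ncard := by
  rw [ncard_autSet_eq_ncard_edgeSetOrbit_mul G E',
    ncard_autSet_eq_ncard_edgeSetOrbit_mul (G.deleteEdges E') E']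
  simp only [mem_autSet_and_iff_deleteEdges G hsub]
  ring
end

section
/- Let G = (V, E) be a finite connected simple undirected graph with |V| ≥ 3, and let v ∈ V. Then |AO_G(e_G(v))| = |AO_G(v)|, i.e., the automorphism orbit of the incidence edge set of v (as a set of edges) has the same cardinality as the automorphism orbit of the vertex v. -/
/-- In a preconnected graph, two distinct vertices with the same incidence set are the only
vertices. -/
theorem SimpleGraph.Preconnected.eq_or_eq_of_incidenceSet_eq {V : Type*} {G : SimpleGraph V}
    (hG : G.Preconnected) {u w : V} (huw : u ≠ w) (h : G.incidenceSet u = G.incidenceSet w)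
    (x : V) : x = u ∨ x = w := by
  have adj_left (y : V) (hy : G.Adj u y) : y = w := by
    have hmem : s(u, y) ∈ G.incidenceSet w := h ▸ ⟨hy, Sym2.mem_mk_left u y⟩
    exact ((Sym2.mem_iff.1 hmem.2).resolve_left huw.symm).symm
  have adj_right (y : V) (hy : G.Adj w y) : y = u := by
    have hmem : s(w, y) ∈ G.incidenceSet u := h ▸ ⟨hy, Sym2.mem_mk_left w y⟩
    exact ((Sym2.mem_iff.1 hmem.2).resolve_left huw).symm
  have closed {a b : V} (p : G.Walk a b) : a = u ∨ a = w → b = u ∨ b = w := by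
    induction p with
    | nil => exact id
    | cons hadj _ ih =>
      rintro (rfl | rfl)
      · exact ih (Or.inr (adj_left _ hadj))
      · exact ih (Or.inl (adj_right _ hadj))
  obtain ⟨p⟩ := hG u x
  exact closed p (Or.inl rfl)

/-- In a preconnected graph with at least three vertices, a vertex is determined by its
incidence set. -/
theorem SimpleGraph.Preconnected.incidenceSet_injective {V : Type*} [Fintype V]
    {G : SimpleGraph V} (hG : G.Preconnected) (hcard : 3 ≤ Fintype.card V) :
    Function.Injective G.incidenceSet := by
  classical
  intro u w h
  by_contra huw
  have huniv : (Finset.univ : Finset V) ⊆ {u, w} := fun x _ => by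
    simpa using hG.eq_or_eq_of_incidenceSet_eq huw h x
  have hle : Fintype.card V ≤ 2 := (Finset.card_le_card huniv).trans Finset.card_le_two
  omega

/-- An automorphism carries the incidence set of `v` onto the incidence set of the image
of `v`. -/
theorem pairSetMap_incidenceSet {V : Type*} {G : SimpleGraph V} {σ : Equiv.Perm V}
    (hσ : σ ∈ autSet G) (v : V) :
    pairSetMap σ (G.incidenceSet v) = G.incidenceSet (σ v) := by
  ext e
  constructor
  · rintro ⟨e, ⟨he, hv⟩, rfl⟩
    refine ⟨?_, Sym2.mem_map.2 ⟨v, hv, rfl⟩⟩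
    induction e with
    | _ a b => exact (hσ a b).1 he
  · rintro ⟨he, hv⟩
    obtain ⟨b, rfl⟩ := hv
    obtain ⟨b, rfl⟩ := σ.surjective b
    exact ⟨s(v, b), ⟨(hσ v b).2 he, Sym2.mem_mk_left v b⟩, rfl⟩

/-- The orbit of the incidence set of `v` consists of the incidence sets of the vertices in the
orbit of `v`. -/
theorem edgeSetOrbit_incidenceSet {V : Type*} (G : SimpleGraph V) (v : V) :
    edgeSetOrbit G (G.incidenceSet v) = G.incidenceSet '' vertexOrbit G v := by
  ext T
  constructor
  · rintro ⟨σ, hσ, rfl⟩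
    exact ⟨σ v, ⟨σ, hσ, rfl⟩, (pairSetMap_incidenceSet hσ v).symm⟩
  · rintro ⟨_, ⟨σ, hσ, rfl⟩, rfl⟩
    exact ⟨σ, hσ, pairSetMap_incidenceSet hσ v⟩

/-- In a finite connected simple graph `G` with at least 3 vertices, for any
vertex `v`, the automorphism orbit of the incidence edge set of `v` (as a set of edges) has
the same cardinality as the automorphism orbit of the vertex `v`:
`|AO_G(e_G(v))| = |AO_G(v)|`. -/
theorem card_orbit_incidenceSet_eq_card_orbit_vertex {V : Type*} [Fintype V]
    (G : SimpleGraph V) (hconn : G.Connected) (hcard : 3 ≤ Fintype.card V) (v : V) :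
    (edgeSetOrbit G (G.incidenceSet v)).ncard = (vertexOrbit G v).ncard := by
  rw [edgeSetOrbit_incidenceSet]
  exact Set.ncard_image_of_injective _ (hconn.preconnected.incidenceSet_injective hcard)
end

section
/- Let G = (V, E) be a finite connected simple undirected graph with |V| ≥ 3, let v ∈ V be a vertex with e_G(v) ≠ ∅, and let G' = G − e_G(v) = (V, E ∖ e_G(v)) be the graph obtained by deleting from G all edges incident on v (but keeping the vertex v). Then |Aut(G)| · |AO_{G'}(e_G(v))| = |Aut(G')| · |AO_G(v)|. -/
/-- The automorphisms of `G` as a subgroup of the permutations of its vertices. -/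
def autSubgroup {V : Type*} (G : SimpleGraph V) : Subgroup (Equiv.Perm V) where
  carrier := autSet G
  one_mem' := fun _ _ => Iff.rfl
  mul_mem' := fun hσ hτ a b => (hτ a b).trans (hσ _ _)
  inv_mem' := fun {σ} hσ a b => by simpa using (hσ (σ⁻¹ a) (σ⁻¹ b)).symm

/-- Permutations of the vertices act on sets of unordered pairs. -/
abbrev pairSetAction (V : Type*) : MulAction (Equiv.Perm V) (Set (Sym2 V)) where
  smul := pairSetMap
  one_smul S := by
    change Sym2.map id '' S = S
    rw [Sym2.map_id, Set.image_id]
  mul_smul σ τ S := by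
    change Sym2.map (σ ∘ τ) '' S = Sym2.map σ '' (Sym2.map τ '' S)
    rw [Sym2.map_comp, Set.image_comp]

/-- The orbit-stabilizer theorem for the action of a subgroup, with all three cardinalities
taken in the ambient types. -/
theorem Subgroup.ncard_orbit_mul_ncard_stabilizer {Γ X : Type*} [Group Γ] [MulAction Γ X]
    (H : Subgroup Γ) (x : X) :
    {y | ∃ σ ∈ H, σ • x = y}.ncard * {σ | σ ∈ H ∧ σ • x = x}.ncard = (H : Set Γ).ncard := by
  have horbit : {y | ∃ σ ∈ H, σ • x = y} = MulAction.orbit H x := by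
    ext y
    simp [MulAction.mem_orbit_iff, Subgroup.smul_def]
  have hstab : {σ | σ ∈ H ∧ σ • x = x} =
      ((↑) : H → Γ) '' (MulAction.stabilizer H x : Set H) := by
    ext σ
    simp [MulAction.mem_stabilizer_iff, Subgroup.smul_def, and_comm]
  rw [horbit, hstab, Set.ncard_image_of_injective _ Subtype.val_injective,
    ← Nat.card_coe_set_eq, ← Nat.card_coe_set_eq, ← Nat.card_coe_set_eq, ← Nat.card_prod]
  exact Nat.card_congr (MulAction.orbitProdStabilizerEquivGroup H x)

theorem mk_mem_pairSetMap_iff {V : Type*} (σ : Equiv.Perm V) (S : Set (Sym2 V)) (a b : V) :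
    s(σ a, σ b) ∈ pairSetMap σ S ↔ s(a, b) ∈ S :=
  (Sym2.map.injective σ.injective).mem_set_image (a := s(a, b))

theorem pairSetMap_eq_self_iff {V : Type*} (σ : Equiv.Perm V) (S : Set (Sym2 V)) :
    pairSetMap σ S = S ↔ ∀ a b, s(σ a, σ b) ∈ S ↔ s(a, b) ∈ S := by
  refine ⟨fun h a b => ?_, fun h => ?_⟩
  · rw [← mk_mem_pairSetMap_iff σ S a b, h]
  · ext e
    induction e with
    | h x y =>
      obtain ⟨a, rfl⟩ := σ.surjective x
      obtain ⟨b, rfl⟩ := σ.surjective y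
      rw [mk_mem_pairSetMap_iff, h]

/-- If all neighbours of `v` and of `w` lie in `{v, w}`, then a connected graph has no
other vertex. -/
theorem SimpleGraph.Connected.eq_or_eq_of_adj {V : Type*} {G : SimpleGraph V}
    (hconn : G.Connected) {v w : V} (hv : ∀ x, G.Adj v x → x = w)
    (hw : ∀ x, G.Adj w x → x = v) (u : V) : u = v ∨ u = w := by
  obtain ⟨p⟩ := hconn.preconnected u v
  induction p with
  | nil => exact Or.inl rfl
  | cons h _ ih =>
    rcases ih hv hw with rfl | rfl
    · exact Or.inr (hv _ h.symm)
    · exact Or.inl (hw _ h.symm)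

/-- An automorphism of `G` fixing `v` is the same thing as an automorphism of the graph without
the edges at `v` that preserves the set of these edges. -/
theorem autSet_and_fix_iff {V : Type*} [Fintype V]
    (G : SimpleGraph V) (hconn : G.Connected) (hcard : 3 ≤ Fintype.card V) (v : V)
    (σ : Equiv.Perm V) :
    (σ ∈ autSet G ∧ σ v = v) ↔
      (σ ∈ autSet (G.deleteEdges (G.incidenceSet v)) ∧
        pairSetMap σ (G.incidenceSet v) = G.incidenceSet v) := by
  classical
  have hinc : ∀ a b, s(a, b) ∈ G.incidenceSet v ↔ G.Adj a b ∧ (v = a ∨ v = b) := by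
    intro a b
    simp [SimpleGraph.mk'_mem_incidenceSet_iff]
  simp only [pairSetMap_eq_self_iff, autSet, Set.mem_ofPred_eq, SimpleGraph.deleteEdges_adj, hinc]
  constructor
  · rintro ⟨hσ, hfix⟩
    have hv : ∀ a, v = σ a ↔ v = a := fun a => by
      rw [← σ.injective.eq_iff (a := v) (b := a), hfix]
    simp only [hv, ← hσ]
    simp
  · rintro ⟨hdel, hset⟩
    refine ⟨fun a b => ?_, ?_⟩
    · have := hdel a b
      have := hset a b
      tauto
    · by_contra hne
      have hv : ∀ x, G.Adj v x → x = σ v := by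
        intro x hx
        obtain ⟨y, rfl⟩ := σ.surjective x
        obtain ⟨z, hz⟩ := σ.surjective v
        have h := (hset z y).1 ⟨hz ▸ hx, Or.inl hz.symm⟩
        rcases h.2 with rfl | rfl
        · exact absurd hz hne
        · rfl
      have hw : ∀ x, G.Adj (σ v) x → x = v := by
        intro x hx
        obtain ⟨y, rfl⟩ := σ.surjective x
        by_contra hx'
        have h := (hdel v y).2 ⟨hx, fun hh => hh.2.elim (hne ·.symm) (hx' ·.symm)⟩
        exact h.2 ⟨h.1, Or.inl rfl⟩
      have hsub : (Finset.univ : Finset V) ⊆ {v, σ v} := fun u _ => by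
        simpa using hconn.eq_or_eq_of_adj hv hw u
      have := (Finset.card_le_card hsub).trans Finset.card_le_two
      rw [Finset.card_univ] at this
      omega

/-- Let `G = (V, E)` be a finite connected simple graph with `|V| ≥ 3`, let
`v ∈ V` with `e_G(v) ≠ ∅`, and let `G' = G − e_G(v)` be obtained by deleting all edges
incident on `v` (keeping the vertex). Then
`|Aut(G)| · |AO_{G'}(e_G(v))| = |Aut(G')| · |AO_G(v)|`. -/
theorem aut_mul_orbit_incidence_eq {V : Type*} [Fintype V]
    (G : SimpleGraph V) (hconn : G.Connected) (hcard : 3 ≤ Fintype.card V)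
    (v : V) (hv : (G.incidenceSet v).Nonempty) :
    (autSet G).ncard *
        (edgeSetOrbit (G.deleteEdges (G.incidenceSet v)) (G.incidenceSet v)).ncard =
      (autSet (G.deleteEdges (G.incidenceSet v))).ncard * (vertexOrbit G v).ncard := by
  let G' := G.deleteEdges (G.incidenceSet v)
  let := pairSetAction V
  have hG : (vertexOrbit G v).ncard * {σ | σ ∈ autSet G ∧ σ v = v}.ncard = (autSet G).ncard :=
    (autSubgroup G).ncard_orbit_mul_ncard_stabilizer v
  have hG' : (edgeSetOrbit G' (G.incidenceSet v)).ncard *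
      {σ | σ ∈ autSet G' ∧ pairSetMap σ (G.incidenceSet v) = G.incidenceSet v}.ncard =
        (autSet G').ncard :=
    (autSubgroup G').ncard_orbit_mul_ncard_stabilizer (G.incidenceSet v)
  simp only [autSet_and_fix_iff G hconn hcard v] at hG
  rw [← hG, ← hG']
  ring
end
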